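/- arXiv:1901.03679 — 2 statements merged into one kernel-verified Lean document; each statement's English description precedes it below -/
import Mathlib

section
/- The monic quintic f has one real double root, one real simple root, and one pair of nonreal complex-conjugate simple roots — i.e., there exist distinct real numbers a, b and a nonreal w ∈ ℂ with f(X) = (X−a)^2(X−b)(X−w)(X−conj(w)) over ℂ — if and only if D = 0 and L1 < 0. -/
open Polynomial

noncomputable section

def quinticL1 (p q r s t : ℝ) : ℝ :=
  -264*p*r*s^2 - 12*p^3*q^2*t + 36*p*q*r^3 - 124*p*q^2*r*s + 28*p^3*q*r*s + 260*p*q*s*t - 132*p^2*q*r*t + 240*p*r^2*t + 234*q*r^2*s + 32*p^4*r*t + 48*p*q^3*t - 56*p^3*s*t - 80*q^2*r*t + 194*p^2*q*s^2 - 600*r*s*t - 6*p^2*q^3*s + 2*p^2*q^2*r^2 - 12*p^2*r^2*s - 54*r^4 + 320*s^3 - 8*q^3*r^2 - 8*p^3*r^3 + 250*q*t^2 - 176*q^2*s^2 + 24*q^4*s - 36*p^4*s^2 - 100*p^2*t^2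

theorem monic_quintic_coeffs_inj {R : Type*} [Semiring R] {p q r s t p' q' r' s' t' : R}
    (h : (X ^ 5 + C p * X ^ 4 + C q * X ^ 3 + C r * X ^ 2 + C s * X + C t : R[X]) =
      X ^ 5 + C p' * X ^ 4 + C q' * X ^ 3 + C r' * X ^ 2 + C s' * X + C t') :
    p = p' ∧ q = q' ∧ r = r' ∧ s = s' ∧ t = t' := by
  refine ⟨?_, ?_, ?_, ?_, ?_⟩
  · simpa [coeff_X, coeff_C, coeff_X_pow] using congrArg (fun f => coeff f 4) h
  · simpa [coeff_X, coeff_C, coeff_X_pow] using congrArg (fun f => coeff f 3) h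
  · simpa [coeff_X, coeff_C, coeff_X_pow] using congrArg (fun f => coeff f 2) h
  · simpa [coeff_X, coeff_C, coeff_X_pow] using congrArg (fun f => coeff f 1) h
  · simpa [coeff_X, coeff_C, coeff_X_pow] using congrArg (fun f => coeff f 0) h

/-- Vieta's formulas for a monic quintic with a repeated root. -/
theorem quintic_coeffs_of_double_root {p q r s t a b c d : ℂ}
    (h : (X ^ 5 + C p * X ^ 4 + C q * X ^ 3 + C r * X ^ 2 + C s * X + C t : ℂ[X]) =
      (X - C a) ^ 2 * (X - C b) * (X - C c) * (X - C d)) :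
    p = -(2 * a + b + c + d) ∧
    q = a ^ 2 + 2 * a * (b + c + d) + (b * c + b * d + c * d) ∧
    r = -(a ^ 2 * (b + c + d) + 2 * a * (b * c + b * d + c * d) + b * c * d) ∧
    s = a ^ 2 * (b * c + b * d + c * d) + 2 * a * (b * c * d) ∧
    t = -(a ^ 2 * (b * c * d)) := by
  have e : (X - C a) ^ 2 * (X - C b) * (X - C c) * (X - C d) =
      X ^ 5 + C (-(2 * a + b + c + d)) * X ^ 4
      + C (a ^ 2 + 2 * a * (b + c + d) + (b * c + b * d + c * d)) * X ^ 3
      + C (-(a ^ 2 * (b + c + d) + 2 * a * (b * c + b * d + c * d) + b * c * d)) * X ^ 2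
      + C (a ^ 2 * (b * c + b * d + c * d) + 2 * a * (b * c * d)) * X
      + C (-(a ^ 2 * (b * c * d))) := by
    simp only [map_add, map_mul, map_neg, map_pow, map_ofNat]
    ring
  exact monic_quintic_coeffs_inj (h.trans e)

/-- On quintics with a repeated root, `quinticL1` is twice the discriminant of the product of the
four factors `X - a`, `X - b`, `X - c`, `X - d`. -/
theorem quinticL1_eq_of_double_root {p q r s t : ℝ} {a b c d : ℂ}
    (h : (X ^ 5 + C (p : ℂ) * X ^ 4 + C (q : ℂ) * X ^ 3 + C (r : ℂ) * X ^ 2 + C (s : ℂ) * X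
      + C (t : ℂ) : ℂ[X]) = (X - C a) ^ 2 * (X - C b) * (X - C c) * (X - C d)) :
    (quinticL1 p q r s t : ℂ) =
      2 * ((a - b) * (a - c) * (a - d) * (b - c) * (b - d) * (c - d)) ^ 2 := by
  obtain ⟨hp, hq, hr, hs, ht⟩ := quintic_coeffs_of_double_root h
  simp only [quinticL1]
  push_cast
  rw [hp, hq, hr, hs, ht]
  ring

/-- The discriminant of a product of linear factors vanishes iff two of the roots coincide. -/
theorem prod_sub_sq_eq_zero_iff_not_injective (z : Fin 5 → ℂ) :
    ∏ i : Fin 5, ∏ j ∈ Finset.Ioi i, (z i - z j) ^ 2 = 0 ↔ ¬ Function.Injective z := by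
  simp only [Finset.prod_eq_zero_iff, Finset.mem_univ, true_and, Finset.mem_Ioi,
    pow_eq_zero_iff two_ne_zero, sub_eq_zero]
  constructor
  · rintro ⟨i, j, hij, h⟩ hz
    exact hij.ne (hz h)
  · intro hz
    simp only [Function.Injective, not_forall] at hz
    obtain ⟨i, j, h, hij⟩ := hz
    rcases lt_or_gt_of_ne hij with hlt | hlt
    · exact ⟨i, j, hlt, h⟩
    · exact ⟨j, i, hlt, h.symm⟩

theorem exists_double_root_of_not_injective {z : Fin 5 → ℂ} (hz : ¬ Function.Injective z) :
    ∃ a b c d : ℂ, ∏ i : Fin 5, (X - C (z i)) =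
      (X - C a) ^ 2 * (X - C b) * (X - C c) * (X - C d) := by
  simp only [Function.Injective, not_forall] at hz
  obtain ⟨i, j, h, hij⟩ := hz
  have hj : j ∈ Finset.univ.erase i := by simp [Ne.symm hij]
  have hcard : ((Finset.univ.erase i).erase j).card = 3 := by
    rw [Finset.card_erase_of_mem hj, Finset.card_erase_of_mem (Finset.mem_univ i)]
    simp
  obtain ⟨k, l, m, hkl, hkm, hlm, hS⟩ := Finset.card_eq_three.mp hcard
  refine ⟨z i, z k, z l, z m, ?_⟩
  rw [← Finset.mul_prod_erase _ _ (Finset.mem_univ i), ← Finset.mul_prod_erase _ _ hj, hS,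
    Finset.prod_insert (by simp [hkl, hkm]), Finset.prod_pair hlm, h]
  ring

theorem not_injective_of_prod_eq_sq_mul {z : Fin 5 → ℂ} {a : ℂ} {g : ℂ[X]}
    (h : ∏ i : Fin 5, (X - C (z i)) = (X - C a) ^ 2 * g) : ¬ Function.Injective z := by
  intro hz
  have hsq : Squarefree (∏ i : Fin 5, (X - C (z i))) :=
    (separable_prod_X_sub_C_iff.mpr hz).squarefree
  exact not_isUnit_X_sub_C a (hsq (X - C a) ⟨g, by rw [h, sq]⟩)

/-- If a real quintic has a double root `a` and simple roots `b`, `c`, `d`, then `a` is real and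
conjugation permutes the simple roots. -/
theorem conj_roots_of_double_root {p q r s t : ℝ} {a b c d : ℂ}
    (h : (X ^ 5 + C (p : ℂ) * X ^ 4 + C (q : ℂ) * X ^ 3 + C (r : ℂ) * X ^ 2 + C (s : ℂ) * X
      + C (t : ℂ) : ℂ[X]) = (X - C a) ^ 2 * (X - C b) * (X - C c) * (X - C d))
    (hab : a ≠ b) (hac : a ≠ c) (had : a ≠ d) (hbc : b ≠ c) (hbd : b ≠ d) (hcd : c ≠ d) :
    starRingEnd ℂ a = a ∧ ∀ x, x = b ∨ x = c ∨ x = d →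
      starRingEnd ℂ x = b ∨ starRingEnd ℂ x = c ∨ starRingEnd ℂ x = d := by
  have hev (x : ℂ) : x ^ 5 + p * x ^ 4 + q * x ^ 3 + r * x ^ 2 + s * x + t =
      (x - a) ^ 2 * (x - b) * (x - c) * (x - d) := by
    simpa using congrArg (eval x) h
  have hder (x : ℂ) : 5 * x ^ 4 + 4 * p * x ^ 3 + 3 * q * x ^ 2 + 2 * r * x + s =
      2 * (x - a) * (x - b) * (x - c) * (x - d) + (x - a) ^ 2 * (x - c) * (x - d)
        + (x - a) ^ 2 * (x - b) * (x - d) + (x - a) ^ 2 * (x - b) * (x - c) := by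
    obtain ⟨hp, hq, hr, hs, -⟩ := quintic_coeffs_of_double_root h
    rw [hp, hq, hr, hs]
    ring
  have hconj (x : ℂ) (hx : (x - a) ^ 2 * (x - b) * (x - c) * (x - d) = 0) :
      starRingEnd ℂ x = a ∨ starRingEnd ℂ x = b ∨ starRingEnd ℂ x = c ∨
        starRingEnd ℂ x = d := by
    have h0 := congrArg (starRingEnd ℂ) ((hev x).trans hx)
    simp only [map_add, map_mul, map_pow, Complex.conj_ofReal, map_zero] at h0
    rw [hev] at h0
    simpa [sub_eq_zero, or_assoc] using h0
  have ha : starRingEnd ℂ a = a := by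
    have h1 : 5 * a ^ 4 + 4 * p * a ^ 3 + 3 * q * a ^ 2 + 2 * r * a + s = 0 := by
      rw [hder]; ring
    have h2 := congrArg (starRingEnd ℂ) h1
    simp only [map_add, map_mul, map_pow, Complex.conj_ofReal, map_zero, map_ofNat] at h2
    rw [hder] at h2
    rcases hconj a (by ring) with e | e | e | e
    · exact e
    · simp [e, sub_eq_zero, hab.symm, hbc, hbd] at h2
    · simp [e, sub_eq_zero, hac.symm, hbc.symm, hcd] at h2
    · simp [e, sub_eq_zero, had.symm, hbd.symm, hcd.symm] at h2
  refine ⟨ha, fun x hx => ?_⟩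
  have hxa : x ≠ a := by rcases hx with rfl | rfl | rfl <;> exact Ne.symm ‹_›
  have hroot : (x - a) ^ 2 * (x - b) * (x - c) * (x - d) = 0 := by
    rcases hx with rfl | rfl | rfl <;> ring
  refine (hconj x hroot).resolve_left fun e => hxa ?_
  rw [← Complex.conj_conj x, e, ha]

theorem exists_nonreal_of_permuted_by_conj {b c d : ℂ} (hbc : b ≠ c) (hbd : b ≠ d) (hcd : c ≠ d)
    (hperm : ∀ x, x = b ∨ x = c ∨ x = d →
      starRingEnd ℂ x = b ∨ starRingEnd ℂ x = c ∨ starRingEnd ℂ x = d)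
    (hreal : ¬ (starRingEnd ℂ b = b ∧ starRingEnd ℂ c = c ∧ starRingEnd ℂ d = d)) :
    ∃ (e : ℝ) (w : ℂ), (e = b ∨ e = c ∨ e = d) ∧ w.im ≠ 0 ∧
      (X - C b) * (X - C c) * (X - C d) =
        (X - C (e : ℂ)) * (X - C w) * (X - C (starRingEnd ℂ w)) := by
  have key : ∀ {x y u : ℂ}, x ≠ y → x ≠ u → y ≠ u → starRingEnd ℂ x = y →
      (starRingEnd ℂ u = x ∨ starRingEnd ℂ u = y ∨ starRingEnd ℂ u = u) →
      x.im ≠ 0 ∧ ∃ e : ℝ, (e : ℂ) = u := by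
    intro x y u hxy hxu hyu hx hu
    refine ⟨fun him => hxy ?_, ?_⟩
    · rw [← hx, Complex.conj_eq_iff_im.mpr him]
    · rcases hu with hu | hu | hu
      · exact absurd (by rw [← hx, ← hu, Complex.conj_conj]) hyu
      · exact absurd (by rw [← Complex.conj_conj u, hu, ← hx, Complex.conj_conj]) hxu
      · exact ⟨u.re, Complex.conj_eq_iff_re.mp hu⟩
  have hb := hperm b (by simp)
  have hc := hperm c (by simp)
  have hd := hperm d (by simp)
  by_cases hbc' : starRingEnd ℂ b = c
  · obtain ⟨him, e, he⟩ := key hbc hbd hcd hbc' hd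
    exact ⟨e, b, by simp [he], him, by rw [he, hbc']; ring⟩
  by_cases hbd' : starRingEnd ℂ b = d
  · obtain ⟨him, e, he⟩ := key hbd hbc hcd.symm hbd' (by tauto)
    exact ⟨e, b, by simp [he], him, by rw [he, hbd']; ring⟩
  have hbb : starRingEnd ℂ b = b := by tauto
  have hcb : starRingEnd ℂ c ≠ b := fun hh => hbc (by rw [← hbb, ← hh, Complex.conj_conj])
  have hdb : starRingEnd ℂ d ≠ b := fun hh => hbd (by rw [← hbb, ← hh, Complex.conj_conj])
  by_cases hcd' : starRingEnd ℂ c = d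
  · obtain ⟨him, e, he⟩ := key hcd hbc.symm hbd.symm hcd' (by tauto)
    exact ⟨e, c, by simp [he], him, by rw [he, hcd']⟩
  have hcc : starRingEnd ℂ c = c := by tauto
  have hdc : starRingEnd ℂ d ≠ c := fun hh => hcd (by rw [← hcc, ← hh, Complex.conj_conj])
  exact absurd ⟨hbb, hcc, by tauto⟩ hreal

theorem quintic_one_double_one_single_conj_pair (p q r s t D : ℝ) (z : Fin 5 → ℂ)
    (hf : (X ^ 5 + C (p : ℂ) * X ^ 4 + C (q : ℂ) * X ^ 3 + C (r : ℂ) * X ^ 2 + C (s : ℂ) * X + C (t : ℂ) : Polynomial ℂ) = ∏ i : Fin 5, (X - C (z i)))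
    (hD : (D : ℂ) = ∏ i : Fin 5, ∏ j ∈ Finset.Ioi i, (z i - z j) ^ 2) :
    (∃ (a b : ℝ) (w : ℂ), a ≠ b ∧ w.im ≠ 0 ∧
      (X ^ 5 + C (p : ℂ) * X ^ 4 + C (q : ℂ) * X ^ 3 + C (r : ℂ) * X ^ 2 + C (s : ℂ) * X + C (t : ℂ) : Polynomial ℂ) =
        (X - C (a : ℂ)) ^ 2 * (X - C (b : ℂ)) * (X - C w) * (X - C ((starRingEnd ℂ) w))) ↔
    (D = 0 ∧ quinticL1 p q r s t < 0) := by
  have hD0 : D = 0 ↔ ¬ Function.Injective z := by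
    rw [← prod_sub_sq_eq_zero_iff_not_injective, ← hD, Complex.ofReal_eq_zero]
  constructor
  · rintro ⟨a, b, w, hab, hw, h⟩
    refine ⟨hD0.mpr (not_injective_of_prod_eq_sq_mul (a := (a : ℂ))
      (g := (X - C (b : ℂ)) * (X - C w) * (X - C (starRingEnd ℂ w))) ?_), ?_⟩
    · rw [← hf, h]
      ring
    · have hL : quinticL1 p q r s t =
          -(8 *
            ((a - b) * ((a - w.re) ^ 2 + w.im ^ 2) * ((b - w.re) ^ 2 + w.im ^ 2) * w.im) ^ 2) := by
        have hnorm (x : ℝ) : ((x : ℂ) - w) * (x - starRingEnd ℂ w) =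
            (((x - w.re) ^ 2 + w.im ^ 2 : ℝ) : ℂ) := by
          apply Complex.ext <;> simp only [Complex.ofReal_re, Complex.ofReal_im, Complex.mul_re,
            Complex.mul_im, Complex.sub_re, Complex.sub_im, Complex.conj_re, Complex.conj_im] <;> ring
        apply Complex.ofReal_injective
        calc (quinticL1 p q r s t : ℂ)
            = 2 * ((a - b) * ((a - w) * (a - starRingEnd ℂ w)) *
                ((b - w) * (b - starRingEnd ℂ w)) * (w - starRingEnd ℂ w)) ^ 2 := by
              rw [quinticL1_eq_of_double_root h]; ring
          _ = _ := by
              rw [hnorm, hnorm, Complex.sub_conj]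
              push_cast
              linear_combination (8 * ((a - b) * ((a - w.re) ^ 2 + w.im ^ 2) *
                ((b - w.re) ^ 2 + w.im ^ 2) * w.im) ^ 2 : ℂ) * Complex.I_sq
      have hab' : a - b ≠ 0 := sub_ne_zero.mpr hab
      rw [hL]
      have : 0 < w.im ^ 2 := by positivity
      have : (a - w.re) ^ 2 + w.im ^ 2 ≠ 0 := by positivity
      have : (b - w.re) ^ 2 + w.im ^ 2 ≠ 0 := by positivity
      exact neg_neg_of_pos (by positivity)
  · rintro ⟨hD', hL⟩
    obtain ⟨a, b, c, d, h⟩ := exists_double_root_of_not_injective (hD0.mp hD')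
    rw [← hf] at h
    have hL1 := quinticL1_eq_of_double_root h
    have hne : (2 * ((a - b) * (a - c) * (a - d) * (b - c) * (b - d) * (c - d)) ^ 2 : ℂ) ≠ 0 := by
      rw [← hL1]
      exact_mod_cast hL.ne
    simp only [ne_eq, mul_eq_zero, pow_eq_zero_iff two_ne_zero, OfNat.ofNat_ne_zero, false_or,
      not_or, sub_eq_zero] at hne
    obtain ⟨⟨⟨⟨⟨hab, hac⟩, had⟩, hbc⟩, hbd⟩, hcd⟩ := hne
    obtain ⟨ha, hperm⟩ := conj_roots_of_double_root h hab hac had hbc hbd hcd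
    obtain ⟨a, rfl⟩ := Complex.conj_eq_iff_real.mp ha
    obtain ⟨e, w, he, hw, hg⟩ := exists_nonreal_of_permuted_by_conj hbc hbd hcd hperm (by
      rintro ⟨hb, hc, hd⟩
      obtain ⟨b, rfl⟩ := Complex.conj_eq_iff_real.mp hb
      obtain ⟨c, rfl⟩ := Complex.conj_eq_iff_real.mp hc
      obtain ⟨d, rfl⟩ := Complex.conj_eq_iff_real.mp hd
      have hsq : quinticL1 p q r s t =
          2 * ((a - b) * (a - c) * (a - d) * (b - c) * (b - d) * (c - d)) ^ 2 := by
        exact_mod_cast hL1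
      exact hL.not_ge (hsq ▸ by positivity))
    refine ⟨a, e, w, ?_, hw, ?_⟩
    · rintro rfl
      tauto
    · rw [h]
      linear_combination (X - C (a : ℂ)) ^ 2 * hg
end
end

section
/- The monic quintic f has one real triple root and one real double root — i.e., there exist distinct real numbers a and b with f(X) = (X−a)^3(X−b)^2 — if and only if D = 0, L1 = 0, L2 = 0, L3 ≠ 0 and M1 ≠ 0. -/
open Polynomial

noncomputable section

def quinticL3 (p q : ℝ) : ℝ := 2*p^2 - 5*q

def quinticL2 (p q r s : ℝ) : ℝ :=
  3*p^2*q^2 - 45*r^2 - 8*p^3*r + 40*q*s + 38*p*q*r - 16*p^2*s - 12*q^3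

def quinticM1 (p q r s : ℝ) : ℝ := 8*p^3*r - 80*p^2*s - 3*p^2*q^2 + 10*p*q*r + 200*q*s - 75*r^2

lemma quintic_vieta {R : Type*} [CommRing R] {p q r s t a b c d e : R}
    (h : (X ^ 5 + C p * X ^ 4 + C q * X ^ 3 + C r * X ^ 2 + C s * X + C t : R[X]) =
      (X - C a) * (X - C b) * (X - C c) * (X - C d) * (X - C e)) :
    p = -(a + b + c + d + e) ∧
    q = a*b + a*c + a*d + a*e + b*c + b*d + b*e + c*d + c*e + d*e ∧
    r = -(a*b*c + a*b*d + a*b*e + a*c*d + a*c*e + a*d*e + b*c*d + b*c*e + b*d*e + c*d*e) ∧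
    s = a*b*c*d + a*b*c*e + a*b*d*e + a*c*d*e + b*c*d*e ∧
    t = -(a*b*c*d*e) := by
  have expand : (X - C a) * (X - C b) * (X - C c) * (X - C d) * (X - C e) =
      X ^ 5 + C (-(a + b + c + d + e)) * X ^ 4 +
      C (a*b + a*c + a*d + a*e + b*c + b*d + b*e + c*d + c*e + d*e) * X ^ 3 +
      C (-(a*b*c + a*b*d + a*b*e + a*c*d + a*c*e + a*d*e + b*c*d + b*c*e + b*d*e + c*d*e)) *
        X ^ 2 +
      C (a*b*c*d + a*b*c*e + a*b*d*e + a*c*d*e + b*c*d*e) * X + C (-(a*b*c*d*e)) := by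
    simp only [C_neg, C_add, C_mul]
    ring
  rw [expand] at h
  have coeff_eq (n : ℕ) := congrArg (fun f : R[X] => f.coeff n) h
  have h4 := coeff_eq 4
  have h3 := coeff_eq 3
  have h2 := coeff_eq 2
  have h1 := coeff_eq 1
  have h0 := coeff_eq 0
  simp only [coeff_add, coeff_C_mul, coeff_X_pow, coeff_X, coeff_C] at h4 h3 h2 h1 h0
  norm_num at h4 h3 h2 h1 h0
  refine ⟨?_, ?_, ?_, ?_, ?_⟩
  · linear_combination h4
  · linear_combination h3
  · linear_combination h2
  · linear_combination h1
  · linear_combination h0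

lemma quinticL1_of_double_root {p q r s t : ℝ} {a b c d : ℂ}
    (h : (X ^ 5 + C (p : ℂ) * X ^ 4 + C (q : ℂ) * X ^ 3 + C (r : ℂ) * X ^ 2 + C (s : ℂ) * X +
      C (t : ℂ) : ℂ[X]) = (X - C a) * (X - C a) * (X - C b) * (X - C c) * (X - C d)) :
    (quinticL1 p q r s t : ℂ) =
      2 * ((a - b) * (a - c) * (a - d) * (b - c) * (b - d) * (c - d)) ^ 2 := by
  obtain ⟨hp, hq, hr, hs, ht⟩ := quintic_vieta h
  unfold quinticL1
  push_cast
  rw [hp, hq, hr, hs, ht]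
  ring

lemma quinticL2_of_triple_root {p q r s t : ℝ} {a b c : ℂ}
    (h : (X ^ 5 + C (p : ℂ) * X ^ 4 + C (q : ℂ) * X ^ 3 + C (r : ℂ) * X ^ 2 + C (s : ℂ) * X +
      C (t : ℂ) : ℂ[X]) = (X - C a) * (X - C a) * (X - C a) * (X - C b) * (X - C c)) :
    (quinticL2 p q r s : ℂ) = 3 * ((a - b) * (a - c) * (b - c)) ^ 2 := by
  obtain ⟨hp, hq, hr, hs, -⟩ := quintic_vieta h
  unfold quinticL2
  push_cast
  rw [hp, hq, hr, hs]
  ring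

lemma quinticL2_of_two_double_roots {p q r s t : ℝ} {a b c : ℂ}
    (h : (X ^ 5 + C (p : ℂ) * X ^ 4 + C (q : ℂ) * X ^ 3 + C (r : ℂ) * X ^ 2 + C (s : ℂ) * X +
      C (t : ℂ) : ℂ[X]) = (X - C a) * (X - C a) * (X - C b) * (X - C b) * (X - C c)) :
    (quinticL2 p q r s : ℂ) = 4 * ((a - b) * (a - c) * (b - c)) ^ 2 := by
  obtain ⟨hp, hq, hr, hs, -⟩ := quintic_vieta h
  unfold quinticL2
  push_cast
  rw [hp, hq, hr, hs]
  ring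

lemma quinticM1_of_quadruple_root {p q r s t : ℝ} {a b : ℂ}
    (h : (X ^ 5 + C (p : ℂ) * X ^ 4 + C (q : ℂ) * X ^ 3 + C (r : ℂ) * X ^ 2 + C (s : ℂ) * X +
      C (t : ℂ) : ℂ[X]) = (X - C a) * (X - C a) * (X - C a) * (X - C a) * (X - C b)) :
    quinticM1 p q r s = 0 := by
  obtain ⟨hp, hq, hr, hs, -⟩ := quintic_vieta h
  have : (quinticM1 p q r s : ℂ) = 0 := by
    unfold quinticM1
    push_cast
    rw [hp, hq, hr, hs]
    ring
  exact_mod_cast this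

/-- A real quintic with a complex triple root and a distinct complex double root has both of them
real: their difference `d` has real `d ^ 2` and `d ^ 3`. -/
lemma exists_real_of_triple_double {p q r s t : ℝ} {a b : ℂ} (hab : a ≠ b)
    (h : (X ^ 5 + C (p : ℂ) * X ^ 4 + C (q : ℂ) * X ^ 3 + C (r : ℂ) * X ^ 2 + C (s : ℂ) * X +
      C (t : ℂ) : ℂ[X]) = (X - C a) * (X - C a) * (X - C a) * (X - C b) * (X - C b)) :
    ∃ a b : ℝ, a ≠ b ∧
      (X ^ 5 + C p * X ^ 4 + C q * X ^ 3 + C r * X ^ 2 + C s * X + C t : ℝ[X]) =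
        (X - C a) ^ 3 * (X - C b) ^ 2 := by
  obtain ⟨hp, hq, hr, -, -⟩ := quintic_vieta h
  have hd : a - b ≠ 0 := sub_ne_zero.mpr hab
  have hd2 : (a - b) ^ 2 = (((2 * p ^ 2 - 5 * q) / 3 : ℝ) : ℂ) := by
    push_cast
    rw [hp, hq]
    ring
  have hd3 : (a - b) ^ 3 = ((((-4 * p ^ 3 + 15 * p * q - 25 * r) / (-2)) : ℝ) : ℂ) := by
    push_cast
    rw [hp, hq, hr]
    ring
  obtain ⟨δ, hδ⟩ : ∃ δ : ℝ, a - b = δ := by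
    refine ⟨((-4 * p ^ 3 + 15 * p * q - 25 * r) / (-2)) / ((2 * p ^ 2 - 5 * q) / 3), ?_⟩
    rw [Complex.ofReal_div, ← hd2, ← hd3]
    field_simp
  have ha : a = (((-p + 2 * δ) / 5 : ℝ) : ℂ) := by
    push_cast
    rw [← hδ, hp]
    ring
  have hb : b = (((-p - 3 * δ) / 5 : ℝ) : ℂ) := by
    push_cast
    rw [← hδ, hp]
    ring
  refine ⟨(-p + 2 * δ) / 5, (-p - 3 * δ) / 5, fun he => hab (by rw [ha, hb, he]), ?_⟩
  apply map_injective Complex.ofRealHom Complex.ofRealHom.injective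
  simp only [Polynomial.map_add, Polynomial.map_mul, Polynomial.map_pow, Polynomial.map_sub,
    map_X, map_C, Complex.ofRealHom_eq_coe]
  rw [h, ← ha, ← hb]
  ring

lemma exists_real_of_triple_double_of_quinticL3_ne_zero {p q r s t : ℝ} {a b : ℂ}
    (hL3 : quinticL3 p q ≠ 0)
    (h : (X ^ 5 + C (p : ℂ) * X ^ 4 + C (q : ℂ) * X ^ 3 + C (r : ℂ) * X ^ 2 + C (s : ℂ) * X +
      C (t : ℂ) : ℂ[X]) = (X - C a) * (X - C a) * (X - C a) * (X - C b) * (X - C b)) :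
    ∃ a b : ℝ, a ≠ b ∧
      (X ^ 5 + C p * X ^ 4 + C q * X ^ 3 + C r * X ^ 2 + C s * X + C t : ℝ[X]) =
        (X - C a) ^ 3 * (X - C b) ^ 2 := by
  refine exists_real_of_triple_double ?_ h
  rintro rfl
  obtain ⟨hp, hq, -⟩ := quintic_vieta h
  have : (quinticL3 p q : ℂ) = 0 := by
    unfold quinticL3
    push_cast
    rw [hp, hq]
    ring
  exact hL3 (by exact_mod_cast this)

lemma exists_real_of_triple_root {p q r s t : ℝ} {a b c : ℂ}
    (hL2 : quinticL2 p q r s = 0) (hL3 : quinticL3 p q ≠ 0) (hM1 : quinticM1 p q r s ≠ 0)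
    (h : (X ^ 5 + C (p : ℂ) * X ^ 4 + C (q : ℂ) * X ^ 3 + C (r : ℂ) * X ^ 2 + C (s : ℂ) * X +
      C (t : ℂ) : ℂ[X]) = (X - C a) * (X - C a) * (X - C a) * (X - C b) * (X - C c)) :
    ∃ a b : ℝ, a ≠ b ∧
      (X ^ 5 + C p * X ^ 4 + C q * X ^ 3 + C r * X ^ 2 + C s * X + C t : ℝ[X]) =
        (X - C a) ^ 3 * (X - C b) ^ 2 := by
  have hprod := quinticL2_of_triple_root h
  simp only [hL2, Complex.ofReal_zero, zero_eq_mul, OfNat.ofNat_ne_zero, false_or, ne_eq,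
    not_false_eq_true, pow_eq_zero_iff, mul_eq_zero, sub_eq_zero] at hprod
  rcases hprod with (rfl | rfl) | rfl
  · exact absurd (quinticM1_of_quadruple_root h) hM1
  · exact absurd (quinticM1_of_quadruple_root (h.trans (by ring : _ =
      (X - C a) * (X - C a) * (X - C a) * (X - C a) * (X - C b)))) hM1
  · exact exists_real_of_triple_double_of_quinticL3_ne_zero hL3 h

lemma exists_real_of_two_double_roots {p q r s t : ℝ} {a b c : ℂ}
    (hL2 : quinticL2 p q r s = 0) (hL3 : quinticL3 p q ≠ 0) (hM1 : quinticM1 p q r s ≠ 0)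
    (h : (X ^ 5 + C (p : ℂ) * X ^ 4 + C (q : ℂ) * X ^ 3 + C (r : ℂ) * X ^ 2 + C (s : ℂ) * X +
      C (t : ℂ) : ℂ[X]) = (X - C a) * (X - C a) * (X - C b) * (X - C b) * (X - C c)) :
    ∃ a b : ℝ, a ≠ b ∧
      (X ^ 5 + C p * X ^ 4 + C q * X ^ 3 + C r * X ^ 2 + C s * X + C t : ℝ[X]) =
        (X - C a) ^ 3 * (X - C b) ^ 2 := by
  have hprod := quinticL2_of_two_double_roots h
  simp only [hL2, Complex.ofReal_zero, zero_eq_mul, OfNat.ofNat_ne_zero, false_or, ne_eq,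
    not_false_eq_true, pow_eq_zero_iff, mul_eq_zero, sub_eq_zero] at hprod
  rcases hprod with (rfl | rfl) | rfl
  · exact absurd (quinticM1_of_quadruple_root h) hM1
  · exact exists_real_of_triple_double_of_quinticL3_ne_zero hL3 (h.trans (by ring : _ =
      (X - C a) * (X - C a) * (X - C a) * (X - C b) * (X - C b)))
  · exact exists_real_of_triple_double_of_quinticL3_ne_zero hL3 (h.trans (by ring : _ =
      (X - C b) * (X - C b) * (X - C b) * (X - C a) * (X - C a)))

lemma exists_real_of_double_root {p q r s t : ℝ} {a b c d : ℂ}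
    (hL1 : quinticL1 p q r s t = 0) (hL2 : quinticL2 p q r s = 0) (hL3 : quinticL3 p q ≠ 0)
    (hM1 : quinticM1 p q r s ≠ 0)
    (h : (X ^ 5 + C (p : ℂ) * X ^ 4 + C (q : ℂ) * X ^ 3 + C (r : ℂ) * X ^ 2 + C (s : ℂ) * X +
      C (t : ℂ) : ℂ[X]) = (X - C a) * (X - C a) * (X - C b) * (X - C c) * (X - C d)) :
    ∃ a b : ℝ, a ≠ b ∧
      (X ^ 5 + C p * X ^ 4 + C q * X ^ 3 + C r * X ^ 2 + C s * X + C t : ℝ[X]) =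
        (X - C a) ^ 3 * (X - C b) ^ 2 := by
  have hprod := quinticL1_of_double_root h
  simp only [hL1, Complex.ofReal_zero, zero_eq_mul, OfNat.ofNat_ne_zero, false_or, ne_eq,
    not_false_eq_true, pow_eq_zero_iff, mul_eq_zero, sub_eq_zero] at hprod
  rcases hprod with ((((rfl | rfl) | rfl) | rfl) | rfl) | rfl
  · exact exists_real_of_triple_root hL2 hL3 hM1 h
  · exact exists_real_of_triple_root hL2 hL3 hM1 (h.trans (by ring : _ =
      (X - C a) * (X - C a) * (X - C a) * (X - C b) * (X - C d)))
  · exact exists_real_of_triple_root hL2 hL3 hM1 (h.trans (by ring : _ =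
      (X - C a) * (X - C a) * (X - C a) * (X - C b) * (X - C c)))
  · exact exists_real_of_two_double_roots hL2 hL3 hM1 h
  · exact exists_real_of_two_double_roots hL2 hL3 hM1 (h.trans (by ring : _ =
      (X - C a) * (X - C a) * (X - C b) * (X - C b) * (X - C c)))
  · exact exists_real_of_two_double_roots hL2 hL3 hM1 (h.trans (by ring : _ =
      (X - C a) * (X - C a) * (X - C c) * (X - C c) * (X - C b)))

theorem quintic_triple_and_double (p q r s t D : ℝ) (z : Fin 5 → ℂ)
    (hf : (X ^ 5 + C (p : ℂ) * X ^ 4 + C (q : ℂ) * X ^ 3 + C (r : ℂ) * X ^ 2 + C (s : ℂ) * X + C (t : ℂ) : Polynomial ℂ) = ∏ i : Fin 5, (X - C (z i)))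
    (hD : (D : ℂ) = ∏ i : Fin 5, ∏ j ∈ Finset.Ioi i, (z i - z j) ^ 2) :
    (∃ a b : ℝ, a ≠ b ∧
      (X ^ 5 + C p * X ^ 4 + C q * X ^ 3 + C r * X ^ 2 + C s * X + C t : Polynomial ℝ) = (X - C a) ^ 3 * (X - C b) ^ 2) ↔
    (D = 0 ∧ quinticL1 p q r s t = 0 ∧ quinticL2 p q r s = 0 ∧ quinticL3 p q ≠ 0 ∧
      quinticM1 p q r s ≠ 0) := by
  constructor
  · rintro ⟨a, b, hab, h⟩
    obtain ⟨hp, hq, hr, hs, ht⟩ := quintic_vieta (h.trans (by ring : _ =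
      (X - C a) * (X - C a) * (X - C a) * (X - C b) * (X - C b)))
    have hsub : a - b ≠ 0 := sub_ne_zero.mpr hab
    have hL3 : quinticL3 p q = 3 * (a - b) ^ 2 := by
      unfold quinticL3
      rw [hp, hq]
      ring
    have hM1 : quinticM1 p q r s = -12 * (a - b) ^ 6 := by
      unfold quinticM1
      rw [hp, hq, hr, hs]
      ring
    refine ⟨?_, ?_, ?_, ?_, ?_⟩
    · have hninj : ¬ Function.Injective z := by
        intro hinj
        have hsep := (separable_prod_X_sub_C_iff (f := z)).mpr hinj
        have hmap := congrArg (Polynomial.map Complex.ofRealHom) h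
        simp only [Polynomial.map_add, Polynomial.map_mul, Polynomial.map_pow,
          Polynomial.map_sub, map_X, map_C, Complex.ofRealHom_eq_coe] at hmap
        rw [← hf, hmap] at hsep
        exact not_isUnit_X_sub_C (a : ℂ) (hsep.squarefree _
          ⟨(X - C (a : ℂ)) * (X - C (b : ℂ)) ^ 2, by ring⟩)
      obtain ⟨i, j, hij, hne⟩ : ∃ i j, z i = z j ∧ i ≠ j := by
        simpa [Function.Injective] using hninj
      have hlt : ∃ i j, z i = z j ∧ i < j := by
        rcases lt_or_gt_of_ne hne with hlt | hlt
        · exact ⟨i, j, hij, hlt⟩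
        · exact ⟨j, i, hij.symm, hlt⟩
      obtain ⟨i, j, hij, hlt⟩ := hlt
      have : (D : ℂ) = 0 := by
        rw [hD]
        refine Finset.prod_eq_zero (Finset.mem_univ i)
          (Finset.prod_eq_zero (Finset.mem_Ioi.mpr hlt) ?_)
        rw [hij, sub_self, zero_pow two_ne_zero]
      exact_mod_cast this
    · unfold quinticL1
      rw [hp, hq, hr, hs, ht]
      ring
    · unfold quinticL2
      rw [hp, hq, hr, hs]
      ring
    · rw [hL3]
      positivity
    · rw [hM1]
      exact mul_ne_zero (by norm_num) (pow_ne_zero _ hsub)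
  · rintro ⟨rfl, hL1, hL2, hL3, hM1⟩
    rw [Complex.ofReal_zero, eq_comm, Finset.prod_eq_zero_iff] at hD
    obtain ⟨i, -, hi⟩ := hD
    obtain ⟨j, hj, hij⟩ := Finset.prod_eq_zero_iff.mp hi
    have hne : j ≠ i := (Finset.mem_Ioi.mp hj).ne'
    have hij : z i = z j := sub_eq_zero.mp (pow_eq_zero_iff two_ne_zero |>.mp hij)
    obtain ⟨σ, h0, h1⟩ : ∃ σ : Equiv.Perm (Fin 5), σ 0 = i ∧ σ 1 = j := by
      refine ⟨Equiv.swap 1 (Equiv.swap 0 i j) |>.trans (Equiv.swap 0 i), ?_, ?_⟩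
      · have : Equiv.swap 0 i j ≠ 0 := by
          rw [Ne, Equiv.swap_apply_eq_iff, Equiv.swap_apply_left]
          exact hne
        rw [Equiv.trans_apply, Equiv.swap_apply_of_ne_of_ne (by decide) this.symm,
          Equiv.swap_apply_left]
      · rw [Equiv.trans_apply, Equiv.swap_apply_left, Equiv.swap_apply_self]
    rw [← Equiv.prod_comp σ, Fin.prod_univ_five, h0, h1, ← hij] at hf
    exact exists_real_of_double_root hL1 hL2 hL3 hM1 hf
end
end
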